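/- Let T be a complete first-order theory, Γ an invariant global bigness notion for T, M a model of T with A_Γ ⊆ A ⊆ M, and ā a tuple from M. Then tp(ā, A, M) is Γ-big if and only if tp(ā, acl_M(A), M) is Γ-big. -/

import Mathlib

namespace Shelah482

open FirstOrder Language Cardinal

universe u

variable {L : FirstOrder.Language.{u, u}} {T : L.Theory} {γ : Type u}

/-- The conjunction of a finite list of formulas. -/
def listConj {α : Type u} : List (L.Formula α) → L.Formula α
  | [] => ⊤
  | φ :: l => φ ⊓ listConj l

/-- The complete type of the tuple `a` over the parameter set `A` in `M`. -/
def typeOf (M : Theory.ModelType.{u, u, u} T) (A : Set M) (a : γ → M) :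
    Set (L.Formula (γ ⊕ ↥A)) :=
  { φ | φ.Realize (Sum.elim a Subtype.val) }

/-- `q` is a complete type over `A` in `M` (in the variables `γ`): a maximal set of
formulas with parameters in `A` which is consistent with the elementary diagram of
`M`, i.e. finitely satisfiable in `M`. -/
def IsCompleteTypeOver (M : Theory.ModelType.{u, u, u} T) (A : Set M)
    (q : Set (L.Formula (γ ⊕ ↥A))) : Prop :=
  (∀ l : List (L.Formula (γ ⊕ ↥A)), (∀ φ ∈ l, φ ∈ q) →
      ∃ x : γ → M, (listConj l).Realize (Sum.elim x Subtype.val)) ∧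
  (∀ φ : L.Formula (γ ⊕ ↥A), φ ∈ q ∨ φ.not ∈ q)

/-- The restriction of a type over `A` to a type over a subset `B ⊆ A`. -/
def restrictT {M : Theory.ModelType.{u, u, u} T} {A B : Set M} (h : B ⊆ A)
    (q : Set (L.Formula (γ ⊕ ↥A))) : Set (L.Formula (γ ⊕ ↥B)) :=
  { φ | φ.relabel (Sum.map id (Set.inclusion h)) ∈ q }

/-- A *global bigness notion* `Γ` for `T` (with the parameter set `A_Γ` absorbed into
the language as constants): an assignment, to each model `M` of `T` and each parameter
set `A ⊆ M`, of a collection of *`Γ`-big* complete types over `A`, satisfying local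
character, extension and existence. -/
structure GlobalBigness (L : FirstOrder.Language.{u, u}) (T : L.Theory) (γ : Type u) :
    Type (u + 1) where
  Big : ∀ (M : Theory.ModelType.{u, u, u} T) (A : Set M),
    Set (L.Formula (γ ⊕ ↥A)) → Prop
  localChar : ∀ (M : Theory.ModelType.{u, u, u} T) (A : Set M)
      (q : Set (L.Formula (γ ⊕ ↥A))), IsCompleteTypeOver M A q →
      (Big M A q ↔ ∀ (B : Set M) (hBA : B ⊆ A), B.Finite → Big M B (restrictT hBA q))
  extension : ∀ (M : Theory.ModelType.{u, u, u} T) (A B : Set M) (hAB : A ⊆ B)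
      (q : Set (L.Formula (γ ⊕ ↥A))), IsCompleteTypeOver M A q → Big M A q →
      ∃ q' : Set (L.Formula (γ ⊕ ↥B)),
        IsCompleteTypeOver M B q' ∧ Big M B q' ∧ restrictT hAB q' = q
  existence : ∀ (M : Theory.ModelType.{u, u, u} T) (A : Set M),
      ∃ q : Set (L.Formula (γ ⊕ ↥A)), IsCompleteTypeOver M A q ∧ Big M A q

/-- The algebraic closure `acl_M(A)` of `A` in `M`: the set of elements of `M`
satisfying some formula `φ(y, ā)` with parameters `ā ⊆ A` which has only finitely many
solutions in `M`. -/
def aclSet (M : Theory.ModelType.{u, u, u} T) (A : Set M) : Set M :=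
  { b | ∃ φ : L.Formula (PUnit.{u + 1} ⊕ ↥A),
      φ.Realize (Sum.elim (fun _ => b) Subtype.val) ∧
      { c : M | φ.Realize (Sum.elim (fun _ => c) Subtype.val) }.Finite }

/-- A global bigness notion is *invariant* if `Γ`-bigness of `tp(ā, A, M)` is preserved
by elementary maps (fixing the parameters `A_Γ`, which are constants, pointwise). -/
def GlobalBigness.Invariant (Γ : GlobalBigness L T γ) : Prop :=
  ∀ (M N : Theory.ModelType.{u, u, u} T) (A : Set M) (B : Set N)
    (a : γ → M) (b : γ → N) (e : ↥A → ↥B), Function.Surjective e →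
    (∀ φ : L.Formula (γ ⊕ ↥A),
      φ.Realize (Sum.elim a Subtype.val) ↔
        (φ.relabel (Sum.map id e)).Realize (Sum.elim b Subtype.val)) →
    (Γ.Big M A (typeOf M A a) ↔ Γ.Big N B (typeOf N B b))

theorem realize_listConj {α : Type u} {M : Type u} [L.Structure M] (l : List (L.Formula α))
    (v : α → M) : (listConj l).Realize v ↔ ∀ φ ∈ l, φ.Realize v := by
  induction l with
  | nil => simp [listConj]
  | cons φ l ih => simp [listConj, ih]

theorem isCompleteTypeOver_typeOf (M : Theory.ModelType.{u, u, u} T) (A : Set M) (a : γ → M) :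
    IsCompleteTypeOver M A (typeOf M A a) :=
  ⟨fun l hl => ⟨a, (realize_listConj l _).2 hl⟩, fun φ => em (φ.Realize _)⟩

theorem restrictT_typeOf (M : Theory.ModelType.{u, u, u} T) {A B : Set M} (h : B ⊆ A)
    (a : γ → M) : restrictT h (typeOf M A a) = typeOf M B a := by
  ext φ
  simp only [restrictT, typeOf, Set.mem_ofPred_eq, Formula.realize_relabel, Sum.elim_comp_map]
  rfl

/-- A complete type all of whose formulas are satisfied by `b` is the type of `b`. -/
theorem IsCompleteTypeOver.eq_typeOf {M : Theory.ModelType.{u, u, u} T} {A : Set M}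
    {q : Set (L.Formula (γ ⊕ ↥A))} (hq : IsCompleteTypeOver M A q) {b : γ → M}
    (hb : ∀ φ ∈ q, φ.Realize (Sum.elim b Subtype.val)) : q = typeOf M A b := by
  ext φ
  refine ⟨hb φ, fun h => (hq.2 φ).resolve_right fun hn => ?_⟩
  exact Formula.realize_not.1 (hb _ hn) h

theorem GlobalBigness.big_typeOf_mono (Γ : GlobalBigness L T γ)
    {M : Theory.ModelType.{u, u, u} T} {A B : Set M} (h : B ⊆ A) (a : γ → M)
    (hA : Γ.Big M A (typeOf M A a)) : Γ.Big M B (typeOf M B a) := by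
  rw [Γ.localChar M B _ (isCompleteTypeOver_typeOf M B a)]
  intro C hC hfin
  rw [restrictT_typeOf, ← restrictT_typeOf M (hC.trans h)]
  exact (Γ.localChar M A _ (isCompleteTypeOver_typeOf M A a)).1 hA C _ hfin

/-- Invariance, for parameter sets enumerated by tuples with the same type. -/
theorem GlobalBigness.Invariant.big_iff_of_tuple {Γ : GlobalBigness L T γ} (hInv : Γ.Invariant)
    {M N : Theory.ModelType.{u, u, u} T} {ι : Type u} {s : ι → M} {t : ι → N} {A : Set M}
    {B : Set N} (hA : Set.range s = A) (hB : Set.range t = B) {a : γ → M} {b : γ → N}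
    (h : ∀ φ : L.Formula (γ ⊕ ι), φ.Realize (Sum.elim a s) ↔ φ.Realize (Sum.elim b t)) :
    Γ.Big M A (typeOf M A a) ↔ Γ.Big N B (typeOf N B b) := by
  subst hA hB
  choose g hg using fun x : Set.range s => x.2
  refine hInv M N _ _ a b (fun x => ⟨t (g x), Set.mem_range_self _⟩) ?_ fun φ => ?_
  · rintro ⟨_, i, rfl⟩
    refine ⟨⟨s i, Set.mem_range_self i⟩, Subtype.ext ?_⟩
    have := h (Term.equal (Term.var (Sum.inr (g ⟨s i, Set.mem_range_self i⟩)))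
      (Term.var (Sum.inr i)))
    simp only [Formula.realize_equal, Term.realize_var, Sum.elim_inr] at this
    exact this.1 (hg _)
  · have := h (φ.relabel (Sum.map id g))
    simp only [Formula.realize_relabel, Sum.elim_comp_map, Function.comp_id] at this ⊢
    rwa [show s ∘ g = Subtype.val from funext hg] at this

/-- Every model has an elementary extension (an ultrapower) realizing all sets of formulas with
parameters in the model which are finitely satisfiable in the extension. -/
theorem exists_elementaryEmbedding_realizing (γ : Type u) (M : Theory.ModelType.{u, u, u} T) :
    ∃ (N : Theory.ModelType.{u, u, u} T) (j : M ↪ₑ[L] N), ∀ p : Set (L.Formula (γ ⊕ M)),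
      (∀ s : Finset (L.Formula (γ ⊕ M)), ↑s ⊆ p →
        ∃ x : γ → N, ∀ φ ∈ s, φ.Realize (Sum.elim x j)) →
      ∃ b : γ → N, ∀ φ ∈ p, φ.Realize (Sum.elim b j) := by
  classical
  let I := Finset (L.Formula (γ ⊕ M))
  let U : Ultrafilter I := Ultrafilter.of Filter.atTop
  let P := (U : Filter I).Product fun _ => (M : Type u)
  let j : M ↪ₑ[L] P :=
    ⟨fun m => ((fun _ => m : I → M) : P), fun n φ x =>
      (Ultraproduct.realize_formula_cast φ fun i _ => x i).trans Filter.eventually_const⟩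
  have : P ⊨ T := (j.theory_model_iff T).1 M.is_model
  have los (φ : L.Formula (γ ⊕ M)) (x : γ → I → M) :
      φ.Realize (Sum.elim (fun c => (x c : P)) j) ↔
        ∀ᶠ i in (U : Filter I), φ.Realize (Sum.elim (fun c => x c i) id) := by
    have := Ultraproduct.realize_formula_cast (u := U) φ (Sum.elim x fun m _ => m)
    convert this using 2
    · ext (c | m) <;> rfl
    · ext
      congr! 1
      ext (c | m) <;> rfl
  refine ⟨Theory.ModelType.of T P, j, fun p hp => ?_⟩
  have hex (s : I) : ∃ x : γ → M, ∀ φ ∈ s, φ ∈ p → φ.Realize (Sum.elim x id) := by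
    obtain ⟨x, hx⟩ := hp (s.filter (· ∈ p)) fun φ hφ => (Finset.mem_filter.1 hφ).2
    choose x' hx' using fun c => Quotient.exists_rep (x c)
    obtain rfl : (fun c => (x' c : P)) = x := funext hx'
    have : ∀ᶠ i in (U : Filter I), ∀ φ ∈ s.filter (· ∈ p),
        φ.Realize (Sum.elim (fun c => x' c i) id) :=
      (Filter.eventually_all_finset _).2 fun φ hφ => (los φ x').1 (hx φ hφ)
    obtain ⟨i, hi⟩ := this.exists
    exact ⟨_, fun φ hφ hφp => hi φ (Finset.mem_filter.2 ⟨hφ, hφp⟩)⟩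
  choose x hx using hex
  refine ⟨fun c => ((fun s => x s c : I → M) : P), fun φ hφ => (los φ fun c s => x s c).2 ?_⟩
  have : ∀ᶠ s in (U : Filter I), ({φ} : I) ≤ s :=
    (Filter.eventually_ge_atTop _).filter_mono (Ultrafilter.of_le _)
  exact this.mono fun s hs => hx s φ (hs (Finset.mem_singleton_self φ)) hφ

/-- If `b` in an elementary extension of `M` has the same type over `A` as `a`, and `S` is a finite
subset of `M` closed under conjugation over `A`, then some enumeration of `S` has the same type
over `a` as `S` has over `b`. -/
theorem exists_enum_of_realize_iff {M N : Theory.ModelType.{u, u, u} T} (j : M ↪ₑ[L] N)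
    {A S : Set M} (hS : S.Finite)
    (hθ : ∀ c ∈ S, ∃ θ : L.Formula (PUnit.{u + 1} ⊕ ↥A),
      θ.Realize (Sum.elim (fun _ => c) Subtype.val) ∧
        ∀ d : M, θ.Realize (Sum.elim (fun _ => d) Subtype.val) → d ∈ S)
    {a : γ → M} {b : γ → N}
    (hab : ∀ φ : L.Formula (γ ⊕ ↥A), φ.Realize (Sum.elim b (j ∘ Subtype.val)) →
      φ.Realize (Sum.elim a Subtype.val)) :
    ∃ y : ↥S → M, Set.range y = S ∧ ∀ φ : L.Formula (γ ⊕ ↥S),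
      φ.Realize (Sum.elim a y) ↔ φ.Realize (Sum.elim b (j ∘ Subtype.val)) := by
  have : Finite S := hS
  obtain ⟨e, he⟩ : ∃ e : S → S, ∀ φ : L.Formula (γ ⊕ ↥S),
      φ.Realize (Sum.elim b (j ∘ Subtype.val)) → φ.Realize (Sum.elim a (Subtype.val ∘ e)) := by
    by_contra! hcon
    choose φ hφb hφa using hcon
    choose θ hθ hθS using fun c : S => hθ c c.2
    let χ : L.Formula ((γ ⊕ A) ⊕ S) :=
      (Formula.iInf fun e => (φ e).relabel (Sum.map Sum.inl id)) ⊓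
        Formula.iInf fun c => (θ c).relabel
          (Sum.elim (fun _ => Sum.inr c) fun x => Sum.inl (Sum.inr x))
    have hχ {K : Theory.ModelType.{u, u, u} T} (x : γ → K) (z : A → K) (y : S → K) :
        χ.Realize (Sum.elim (Sum.elim x z) y) ↔ (∀ e, (φ e).Realize (Sum.elim x y)) ∧
          ∀ c, (θ c).Realize (Sum.elim (fun _ => y c) z) := by
      simp only [χ, Formula.realize_inf, Formula.realize_iInf, Formula.realize_relabel,
        Sum.elim_comp_map, Sum.elim_comp_inl, Function.comp_id, Sum.comp_elim]
      rfl
    have hb : (χ.iExs S).Realize (Sum.elim b (j ∘ Subtype.val)) := by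
      refine Formula.realize_iExs.2 ⟨j ∘ Subtype.val, (hχ _ _ _).2 ⟨hφb, fun c => ?_⟩⟩
      have := (j.map_formula (θ c) _).2 (hθ c)
      rwa [Sum.comp_elim] at this
    obtain ⟨y, hy⟩ := Formula.realize_iExs.1 (hab _ hb)
    obtain ⟨hy, hyS⟩ := (hχ _ _ _).1 hy
    exact hφa (fun c => ⟨y c, hθS c _ (hyS c)⟩) (hy _)
  have hiff (φ : L.Formula (γ ⊕ ↥S)) : φ.Realize (Sum.elim a (Subtype.val ∘ e)) ↔
      φ.Realize (Sum.elim b (j ∘ Subtype.val)) :=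
    ⟨fun h => by_contra fun hn => Formula.realize_not.1 (he φ.not (Formula.realize_not.2 hn)) h,
      he φ⟩
  have hinj : Function.Injective e := fun c d hcd => by
    have := hiff (Term.equal (Term.var (Sum.inr c)) (Term.var (Sum.inr d)))
    simp only [Formula.realize_equal, Term.realize_var, Sum.elim_inr, Function.comp_apply, hcd,
      true_iff] at this
    exact Subtype.ext (j.injective this)
  refine ⟨Subtype.val ∘ e, ?_, hiff⟩
  rw [(Finite.surjective_of_injective hinj).range_comp, Subtype.range_val]

/-- A finite subset of `acl(A)` is contained in a finite subset of `acl(A)` closed under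
conjugation over `A`. -/
theorem exists_finite_closed_superset {M : Theory.ModelType.{u, u, u} T} {A B : Set M}
    (hB : B.Finite) (hBA : B ⊆ aclSet M A) :
    ∃ S : Set M, S.Finite ∧ B ⊆ S ∧ ∀ c ∈ S, ∃ θ : L.Formula (PUnit.{u + 1} ⊕ ↥A),
      θ.Realize (Sum.elim (fun _ => c) Subtype.val) ∧
        ∀ d : M, θ.Realize (Sum.elim (fun _ => d) Subtype.val) → d ∈ S := by
  have : Finite B := hB
  choose θ hθ hfin using fun c : B => hBA c.2
  refine ⟨⋃ c, {d : M | (θ c).Realize (Sum.elim (fun _ => d) Subtype.val)},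
    Set.finite_iUnion hfin, fun c hc => Set.mem_iUnion.2 ⟨⟨c, hc⟩, hθ ⟨c, hc⟩⟩, fun c hc => ?_⟩
  obtain ⟨i, hi⟩ := Set.mem_iUnion.1 hc
  exact ⟨θ i, hi, fun d hd => Set.mem_iUnion.2 ⟨i, hd⟩⟩

theorem subset_aclSet (M : Theory.ModelType.{u, u, u} T) (A : Set M) : A ⊆ aclSet M A := by
  intro c hc
  refine ⟨Term.equal (Term.var (Sum.inl PUnit.unit)) (Term.var (Sum.inr ⟨c, hc⟩)), ?_, ?_⟩ <;>
    simp [Formula.realize_equal]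

/-!
Statement 14 (Fact 5.9): for an invariant global bigness notion `Γ`, a model `M` of
`T`, a set `A ⊆ M` and a tuple `ā` from `M`: `tp(ā, A, M)` is `Γ`-big if and only if
`tp(ā, acl_M(A), M)` is `Γ`-big.
-/
theorem big_iff_big_over_acl (hT : T.IsComplete) (Γ : GlobalBigness L T γ)
    (hInv : Γ.Invariant) (M : Theory.ModelType.{u, u, u} T) (A : Set M) (a : γ → M) :
    Γ.Big M A (typeOf M A a) ↔ Γ.Big M (aclSet M A) (typeOf M (aclSet M A) a) := by
  refine ⟨fun hbig => ?_, Γ.big_typeOf_mono (subset_aclSet M A) a⟩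
  rw [Γ.localChar M _ _ (isCompleteTypeOver_typeOf M _ a)]
  intro B hBA hB
  rw [restrictT_typeOf]
  obtain ⟨S, hS, hBS, hθ⟩ := exists_finite_closed_superset hB hBA
  refine Γ.big_typeOf_mono hBS a ?_
  obtain ⟨N, j, hN⟩ := exists_elementaryEmbedding_realizing γ M
  have hrange (C : Set M) : Set.range (j ∘ (Subtype.val : C → M)) = j '' C := by
    rw [Set.range_comp, Subtype.range_val]
  have hbigN : Γ.Big N (j '' A) (typeOf N (j '' A) (j ∘ a)) :=
    (hInv.big_iff_of_tuple Subtype.range_val (hrange A) fun φ => by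
      rw [← Sum.comp_elim, j.map_formula]).1 hbig
  obtain ⟨q, hq, hqbig, hqres⟩ := Γ.extension N (j '' A) (j '' A ∪ j '' S) Set.subset_union_left _
    (isCompleteTypeOver_typeOf N _ _) hbigN
  obtain ⟨b, rfl⟩ : ∃ b, q = typeOf N _ b := by
    have hg (x : ↥(j '' A ∪ j '' S)) : ∃ m : M, j m = x := by
      obtain ⟨_, ⟨m, -, rfl⟩ | ⟨m, -, rfl⟩⟩ := x <;> exact ⟨m, rfl⟩
    choose g hg using hg
    have hrel (φ : L.Formula (γ ⊕ ↥(j '' A ∪ j '' S))) (x : γ → N) :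
        (φ.relabel (Sum.map id g)).Realize (Sum.elim x j) ↔
          φ.Realize (Sum.elim x Subtype.val) := by
      rw [Formula.realize_relabel, Sum.elim_comp_map, Function.comp_id,
        show j ∘ g = Subtype.val from funext hg]
    obtain ⟨b, hb⟩ := hN ((fun φ => φ.relabel (Sum.map id g)) '' q) fun s hs => by
      classical
      obtain ⟨t, ht, rfl⟩ := Finset.subset_set_image_iff.1 hs
      obtain ⟨x, hx⟩ := hq.1 t.toList fun φ hφ => ht (Finset.mem_toList.1 hφ)
      refine ⟨x, fun ψ hψ => ?_⟩
      obtain ⟨φ, hφ, rfl⟩ := Finset.mem_image.1 hψ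
      exact (hrel φ x).2 ((realize_listConj _ _).1 hx φ (Finset.mem_toList.2 hφ))
    exact ⟨b, hq.eq_typeOf fun φ hφ => (hrel φ b).1 (hb _ ⟨φ, hφ, rfl⟩)⟩
  rw [restrictT_typeOf] at hqres
  obtain ⟨y, hyS, hy⟩ := exists_enum_of_realize_iff j hS hθ (a := a) (b := b) fun φ hφ => by
    let e : A → ↥(j '' A) := fun x => ⟨j x, Set.mem_image_of_mem j x.2⟩
    have he (x : γ → N) : (φ.relabel (Sum.map id e)).Realize (Sum.elim x Subtype.val) ↔
        φ.Realize (Sum.elim x (j ∘ Subtype.val)) := by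
      rw [Formula.realize_relabel, Sum.elim_comp_map]
      rfl
    have hmem : φ.relabel (Sum.map id e) ∈ typeOf N (j '' A) b := (he b).2 hφ
    rw [hqres] at hmem
    rw [← j.map_formula, Sum.comp_elim]
    exact (he _).1 hmem
  exact (hInv.big_iff_of_tuple hyS (hrange S) hy).2
    (Γ.big_typeOf_mono Set.subset_union_right b hqbig)

end Shelah482
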